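/- Define the electromagnetic field tensor F_{ab} = Σ_{c,d} ε_{abcd} u^c H^d (the RMHD approximation with vanishing electric field) and, for a constant λ, the Minkowski energy-momentum tensor (T_EM)_{ab} = λ(F_{ac}F_b{}^c − (1/4)η_{ab}F_{cd}F^{cd}), indices raised with η. Then (T_EM)_{ab} = (λH²/2)(u_a u_b − n_a n_b) + (λH²/2)p_{ab}, where H² = H_aH^a; i.e., the electromagnetic field defines a perfect string fluid with −μ = p∥ = −p⊥ = −(1/2)λH². -/

import Mathlib

/-- Integer values of the Levi-Civita symbol with third index `0`. -/
def epsTable : Fin 4 → Fin 4 → Fin 4 → ℤ := fun a b d =>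
  if (a = 1 ∧ b = 2 ∧ d = 3) ∨ (a = 2 ∧ b = 3 ∧ d = 1) ∨ (a = 3 ∧ b = 1 ∧ d = 2) then 1
  else if (a = 2 ∧ b = 1 ∧ d = 3) ∨ (a = 3 ∧ b = 2 ∧ d = 1) ∨ (a = 1 ∧ b = 3 ∧ d = 2) then -1
  else 0

theorem epsTable_eq : ∀ a b d : Fin 4,
    (∑ σ : Equiv.Perm (Fin 4), if σ 0 = a ∧ σ 1 = b ∧ σ 2 = 0 ∧ σ 3 = d then
      (Equiv.Perm.sign σ : ℤ) else 0) = epsTable a b d := by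
  decide +kernel

open Matrix in
/-- in the RMHD approximation (vanishing electric field) the
electromagnetic energy-momentum tensor equals
(λH²/2)(u_a u_b − n_a n_b) + (λH²/2)p_{ab}: a perfect string fluid with
−μ = p∥ = −p⊥ = −(1/2)λH². -/
theorem stmt_6 (lam : ℝ)
    (η : Matrix (Fin 4) (Fin 4) ℝ) (hη : η = Matrix.diagonal ![-1, 1, 1, 1])
    (u : Fin 4 → ℝ) (hu : u = ![1, 0, 0, 0])
    (H : Fin 4 → ℝ) (hH0 : H 0 = 0) (hHne : H ≠ 0)
    (H2 : ℝ) (hH2 : H2 = ∑ a, ∑ b, η a b * H a * H b)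
    (n : Fin 4 → ℝ) (hn : n = fun a => H a / Real.sqrt H2)
    (ε : Fin 4 → Fin 4 → Fin 4 → Fin 4 → ℝ)
    (hε : ∀ a b c d, ε a b c d =
      ∑ σ : Equiv.Perm (Fin 4),
        if σ 0 = a ∧ σ 1 = b ∧ σ 2 = c ∧ σ 3 = d then
          ((Equiv.Perm.sign σ : ℤ) : ℝ) else 0)
    (F : Fin 4 → Fin 4 → ℝ)
    (hF : ∀ a b, F a b = ∑ c, ∑ d, ε a b c d * u c * H d)
    (T : Fin 4 → Fin 4 → ℝ)
    (hT : ∀ a b, T a b = lam * ((∑ c, ∑ e, F a c * η c e * F b e) -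
      (1/4) * η a b * ∑ c, ∑ d, ∑ e, ∑ f, η c e * η d f * F c d * F e f)
      )
    (ul nl : Fin 4 → ℝ) (hul : ul = η.mulVec u) (hnl : nl = η.mulVec n)
    (p : Fin 4 → Fin 4 → ℝ)
    (hp : ∀ a b, p a b = η a b + ul a * ul b - nl a * nl b) :
    ∀ a b, T a b = (lam * H2 / 2) * (ul a * ul b - nl a * nl b) +
      (lam * H2 / 2) * p a b := by
  have hε' : ∀ a b d, ε a b 0 d = (epsTable a b d : ℝ) := by
    intro a b d
    rw [hε, ← epsTable_eq]
    push_cast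
    rfl
  have hF' : ∀ a b, F a b = ∑ d, (epsTable a b d : ℝ) * H d := by
    intro a b
    rw [hF, hu]
    simp [Fin.sum_univ_four, hε']
  have hFm : F = ![![0, 0, 0, 0], ![0, 0, H 3, -H 2], ![0, -H 3, 0, H 1], ![0, H 2, -H 1, 0]] := by
    funext a b
    rw [hF']
    fin_cases a <;> fin_cases b <;> simp [Fin.sum_univ_four, epsTable]
  have hH2' : H2 = H 1 ^ 2 + H 2 ^ 2 + H 3 ^ 2 := by
    rw [hH2, hη]
    simp [Fin.sum_univ_four, hH0, Matrix.diagonal_apply]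
    ring
  have hpos : 0 < H2 := by
    rcases (by positivity : 0 ≤ H 1 ^ 2 + H 2 ^ 2 + H 3 ^ 2).lt_or_eq with h | h
    · rw [hH2']; exact h
    · exfalso
      apply hHne
      have h1 : H 1 = 0 := by nlinarith [sq_nonneg (H 1), sq_nonneg (H 2), sq_nonneg (H 3)]
      have h2 : H 2 = 0 := by nlinarith [sq_nonneg (H 1), sq_nonneg (H 2), sq_nonneg (H 3)]
      have h3 : H 3 = 0 := by nlinarith [sq_nonneg (H 1), sq_nonneg (H 2), sq_nonneg (H 3)]
      funext i
      fin_cases i <;> simp [hH0, h1, h2, h3]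
  have hul' : ul = ![-1, 0, 0, 0] := by
    rw [hul, hη, hu]
    funext i
    fin_cases i <;> simp [Matrix.mulVec_diagonal]
  have hnl' : ∀ a, nl a = H a / Real.sqrt H2 := by
    intro a
    rw [hnl, hη, hn]
    fin_cases a <;> simp [Matrix.mulVec_diagonal, hH0]
  have hnn : ∀ a b, H2 * (nl a * nl b) = H a * H b := by
    intro a b
    have hs : Real.sqrt H2 ≠ 0 := (Real.sqrt_pos.2 hpos).ne'
    have hsq : Real.sqrt H2 * Real.sqrt H2 = H2 := Real.mul_self_sqrt hpos.le
    rw [hnl', hnl', div_mul_div_comm, hsq]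
    field_simp
  intro a b
  have hR : (lam * H2 / 2) * (ul a * ul b - nl a * nl b) + (lam * H2 / 2) * p a b
      = lam * (H2 * (ul a * ul b) - H a * H b + H2 / 2 * η a b) := by
    rw [hp, ← hnn]
    ring
  have hS : ∑ c, ∑ d, ∑ e, ∑ f, η c e * η d f * F c d * F e f = 2 * H2 := by
    rw [hη, hFm, hH2']
    simp [Fin.sum_univ_four, Matrix.diagonal_apply]
    ring
  rw [hR, hT, hS, hul', hH2', hFm, hη]
  congr 1
  fin_cases a <;> fin_cases b <;>
    simp [Fin.sum_univ_four, Matrix.diagonal_apply, hH0] <;> ring
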